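/- arXiv:2208.04809 — 2 statements merged into one kernel-verified Lean document; each statement's English description precedes it below -/
import Mathlib

section
/- Let f : (Mat(N,ℂ))^L → ℂ be a polynomial function such that f(gX₁g^{−1},…,gX_Lg^{−1}) = f(X₁,…,X_L) for every invertible g ∈ GL(N,ℂ) and all X₁,…,X_L ∈ Mat(N,ℂ). Then f belongs to the unital ℂ-subalgebra of the algebra of functions (Mat(N,ℂ))^L → ℂ generated by the trace-word functions p_{w;N}, w ∈ W_L. -/
noncomputable section

/-- The product `X_{w₁} ⋯ X_{w_n}` of matrices along a word `w`. -/
def wordProd (L N : ℕ) (X : Fin L → Matrix (Fin N) (Fin N) ℂ) (w : List (Fin L)) :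
    Matrix (Fin N) (Fin N) ℂ :=
  (w.map X).prod

/-- The trace-word polynomial function `p_{w;N}(X₁,…,X_L) = tr(X_{w₁} ⋯ X_{w_n})`. -/
def pW (L N : ℕ) (w : List (Fin L)) : (Fin L → Matrix (Fin N) (Fin N) ℂ) → ℂ :=
  fun X => (wordProd L N X w).trace

/-- The matrix-entry polynomial function `p_{ij;w;N}(X₁,…,X_L) = (X_{w₁} ⋯ X_{w_n})_{ij}`. -/
def pE (L N : ℕ) (w : List (Fin L)) (i j : Fin N) :
    (Fin L → Matrix (Fin N) (Fin N) ℂ) → ℂ :=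
  fun X => wordProd L N X w i j

/-- `f : (Mat(N,ℂ))^L → ℂ` is a polynomial function if it is given by a polynomial in
the `L·N²` matrix entries of its arguments. -/
def IsPolyFun (L N : ℕ) (f : (Fin L → Matrix (Fin N) (Fin N) ℂ) → ℂ) : Prop :=
  ∃ P : MvPolynomial (Fin L × Fin N × Fin N) ℂ,
    ∀ X, f X = MvPolynomial.eval (fun q => X q.1 q.2.1 q.2.2) P

/-- Two tuples with the same multiplicities differ by a permutation. -/
theorem exists_perm_comp_eq_of_sum_single_eq {ι J : Type*} [Fintype ι] {m m' : ι → J}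
    (h : ∑ k, Finsupp.single (m k) 1 = ∑ k, Finsupp.single (m' k) (1 : ℕ)) :
    ∃ σ : Equiv.Perm ι, m' ∘ σ = m := by
  classical
  have key : ∀ c : J, Nonempty ({a // m a = c} ≃ {b // m' b = c}) := by
    intro c
    rw [← Fintype.card_eq, Fintype.card_subtype, Fintype.card_subtype]
    have hc := DFunLike.congr_fun h c
    simp only [Finsupp.finsetSum_apply, Finsupp.single_apply] at hc
    rwa [Finset.card_filter, Finset.card_filter]
  exact ⟨Equiv.ofFiberEquiv fun c => (key c).some, funext fun a => Equiv.ofFiberEquiv_map _ a⟩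

/-- A tensor whose values on generic diagonal pure tensors vanish is orthogonal to all
symmetric tensors. -/
theorem sum_mul_eq_zero_of_symmetric {K J : Type*} [Field K] [Infinite K] [Fintype J] {d : ℕ}
    {q : MvPolynomial J K} (hq : q ≠ 0) {φ b : (Fin d → J) → K}
    (hφ : ∀ x : J → K, MvPolynomial.eval x q ≠ 0 → ∑ m, φ m * ∏ k, x (m k) = 0)
    (hb : ∀ (σ : Equiv.Perm (Fin d)) m, b (m ∘ σ) = b m) :
    ∑ m, φ m * b m = 0 := by
  classical
  set p : MvPolynomial J K :=
    ∑ m : Fin d → J, φ m • MvPolynomial.monomial (∑ k, Finsupp.single (m k) 1) 1 with hp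
  have hpeval : ∀ x, MvPolynomial.eval x p = ∑ m, φ m * ∏ k, x (m k) := by
    intro x
    simp only [hp, map_sum, MvPolynomial.smul_eval]
    refine Finset.sum_congr rfl fun m _ => ?_
    rw [MvPolynomial.monomial_sum_one, map_prod]
    simp [MvPolynomial.eval_monomial]
  have hp0 : p = 0 := by
    have : p * q = 0 := by
      refine MvPolynomial.funext fun x => ?_
      by_cases hx : MvPolynomial.eval x q = 0
      · simp [hx]
      · simp [hpeval, hφ x hx]
    exact (mul_eq_zero.mp this).resolve_right hq
  have hfac : Function.FactorsThrough b
      fun m : Fin d → J => ∑ k, Finsupp.single (m k) (1 : ℕ) := by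
    intro m m' h
    obtain ⟨σ, rfl⟩ := exists_perm_comp_eq_of_sum_single_eq h
    exact hb σ m'
  let Λ : MvPolynomial J K →ₗ[K] K := (MvPolynomial.basisMonomials J K).constr K
    (Function.extend (fun m : Fin d → J => ∑ k, Finsupp.single (m k) (1 : ℕ)) b 0)
  have hΛ : ∀ m : Fin d → J,
      Λ (MvPolynomial.monomial (∑ k, Finsupp.single (m k) 1) 1) = b m := by
    intro m
    refine Eq.trans ?_ (hfac.extend_apply 0 m)
    exact (MvPolynomial.basisMonomials J K).constr_basis K _ (∑ k, Finsupp.single (m k) 1)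
  have := congrArg Λ hp0
  simpa [hp, map_sum, hΛ] using this

/-- Expansion of a multilinear form in its coefficients. -/
theorem MultilinearMap.apply_eq_sum_single {K J : Type*} [Field K] [Fintype J] [DecidableEq J]
    {d : ℕ} (F : MultilinearMap K (fun _ : Fin d => J → K) K) (Y : Fin d → J → K) :
    F Y = ∑ m : Fin d → J, F (fun k => Pi.single (m k) 1) * ∏ k, Y k (m k) := by
  have hY : Y = fun k => ∑ j, Y k j • (Pi.single j 1 : J → K) := by
    funext k
    exact pi_eq_sum_univ' (Y k)
  conv_lhs => rw [hY, F.map_sum]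
  refine Finset.sum_congr rfl fun m _ => ?_
  rw [F.map_smul_univ (fun k => Y k (m k)) (fun k => Pi.single (m k) 1), smul_eq_mul, mul_comm]

/-- Polarization: a multilinear form vanishing on the diagonal has vanishing symmetrization. -/
theorem MultilinearMap.sum_perm_eq_zero_of_diagonal {K J : Type*} [Field K] [Infinite K]
    [Fintype J] {d : ℕ} (F : MultilinearMap K (fun _ : Fin d => J → K) K)
    (hF : ∀ x, F (fun _ => x) = 0) (Y : Fin d → J → K) :
    ∑ σ : Equiv.Perm (Fin d), F (fun k => Y (σ k)) = 0 := by
  classical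
  simp_rw [F.apply_eq_sum_single (fun k => Y _)]
  rw [Finset.sum_comm]
  simp_rw [← Finset.mul_sum]
  refine sum_mul_eq_zero_of_symmetric (q := 1) one_ne_zero
    (fun x _ => by rw [← F.apply_eq_sum_single (fun _ => x), hF]) fun τ m => ?_
  refine Fintype.sum_equiv (Equiv.mulRight τ⁻¹) _ _ fun σ => ?_
  refine Fintype.prod_equiv τ _ _ fun k => ?_
  simp

/-- A homogeneous polynomial is the restriction of a multilinear form to the diagonal. -/
theorem MvPolynomial.IsHomogeneous.exists_multilinearMap {K J : Type*} [Field K] {d : ℕ}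
    {P : MvPolynomial J K} (hP : P.IsHomogeneous d) :
    ∃ F : MultilinearMap K (fun _ : Fin d => J → K) K,
      ∀ x, F (fun _ => x) = MvPolynomial.eval x P := by
  classical
  have key : ∀ s : J →₀ ℕ, s.degree = d →
      ∃ m : Fin d → J, ∑ k, Finsupp.single (m k) 1 = s := by
    intro s hs
    obtain ⟨l, hl⟩ := Quot.exists_rep s.toMultiset
    have hlen : l.length = d := by
      rw [← Multiset.coe_card, ← hs]
      exact (congrArg Multiset.card hl).trans (Finsupp.card_toMultiset s)
    subst hlen
    refine ⟨l.get, Multiset.toFinsupp.symm.injective ?_⟩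
    change Finsupp.toMultiset _ = Finsupp.toMultiset s
    rw [map_sum, ← hl]
    simp only [Finsupp.toMultiset_single, one_smul, List.get_eq_getElem]
    rw [Fin.sum_univ_fun_getElem l fun j => ({j} : Multiset J)]
    exact (Multiset.sum_coe _).symm.trans (Multiset.sum_map_singleton (l : Multiset J))
  have : ∀ s ∈ P.support, ∃ m : Fin d → J, ∑ k, Finsupp.single (m k) 1 = s := fun s hs =>
    key s (by
      by_contra h
      exact MvPolynomial.mem_support_iff.mp hs (hP.coeff_eq_zero h))
  choose m hm using this
  refine ⟨∑ s ∈ P.support.attach, P.coeff s.1 • (MultilinearMap.mkPiAlgebra K (Fin d) K).compLinearMap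
    (fun k => LinearMap.proj (m s.1 s.2 k)), fun x => ?_⟩
  rw [MvPolynomial.eval_eq, _root_.sum_apply, ← Finset.sum_attach P.support]
  refine Finset.sum_congr rfl fun ⟨s, hs⟩ _ => ?_
  simp only [smul_apply, MultilinearMap.compLinearMap_apply,
    MultilinearMap.mkPiAlgebra_apply, LinearMap.proj_apply, smul_eq_mul]
  congr 1
  have h2 : MvPolynomial.eval x (MvPolynomial.monomial s (1 : K)) = ∏ k, x (m s hs k) := by
    conv_lhs => rw [← hm s hs]
    rw [MvPolynomial.monomial_sum_one, map_prod]
    simp [MvPolynomial.eval_monomial]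
  rw [← h2, MvPolynomial.eval_monomial, one_mul, Finsupp.prod]

/-- The place-permutation representation on tensors, in coordinates. -/
def permRep (K ι α : Type*) [Field K] : Representation K (Equiv.Perm ι) ((ι → α) → K) where
  toFun σ := LinearMap.funLeft K K fun i => i ∘ σ
  map_one' := by ext; rfl
  map_mul' σ τ := by ext; rfl

/-- The double centralizer theorem for the place-permutation action on tensors. -/
theorem exists_perm_coeff_of_commute {K ι α : Type*} [Field K] [CharZero K] [Fintype ι]
    [DecidableEq ι] [Fintype α] [DecidableEq α] {C : Matrix (ι → α) (ι → α) K}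
    (hC : ∀ B : Matrix (ι → α) (ι → α) K,
      (∀ (σ : Equiv.Perm ι) i j, B (i ∘ σ) (j ∘ σ) = B i j) → C * B = B * C) :
    ∃ c : Equiv.Perm ι → K, ∀ i j, C i j = ∑ σ, c σ * if i ∘ σ = j then 1 else 0 := by
  classical
  let ρ := permRep K ι α
  have : NeZero (Nat.card (Equiv.Perm ι) : K) :=
    ⟨by simp [Nat.card_eq_fintype_card]⟩
  let e := ρ.asModuleEquiv
  let fC : Module.End (Module.End (MonoidAlgebra K (Equiv.Perm ι)) ρ.asModule) ρ.asModule :=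
    { toFun := fun u => e.symm (C.mulVec (e u))
      map_add' := by intro u v; simp [Matrix.mulVec_add]
      map_smul' := by
        intro T u
        let T' : ((ι → α) → K) →ₗ[K] ((ι → α) → K) :=
          e.toLinearMap ∘ₗ (T.restrictScalars K) ∘ₗ e.symm.toLinearMap
        have hT' : ∀ u, e (T u) = (LinearMap.toMatrix' T').mulVec (e u) := by
          intro u
          rw [← Matrix.toLin'_apply, Matrix.toLin'_toMatrix']
          simp [T']
        have hTρ : ∀ (σ : Equiv.Perm ι) v, T' (ρ σ v) = ρ σ (T' v) := by
          intro σ v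
          have h : e.symm (ρ σ v) = MonoidAlgebra.of K _ σ • e.symm v :=
            ρ.asModuleEquiv_symm_map_rho σ v
          have h' : ∀ u, e (MonoidAlgebra.of K _ σ • u) = ρ σ (e u) := fun u => by
            rw [ρ.asModuleEquiv_map_smul, Representation.asAlgebraHom_of]
          simp only [T', LinearMap.comp_apply, LinearEquiv.coe_coe,
            LinearMap.restrictScalars_apply, h, map_smul, h']
        have hcomm := hC (LinearMap.toMatrix' T') (by
          intro σ i j
          have := congrFun (hTρ σ (Pi.single (j ∘ σ) 1)) i
          rw [LinearMap.toMatrix'_apply, LinearMap.toMatrix'_apply]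
          have h1 : ρ σ (Pi.single (j ∘ σ) 1) = Pi.single j 1 := by
            funext l
            simp only [ρ, permRep, MonoidHom.coe_mk, OneHom.coe_mk, LinearMap.funLeft_apply,
              Pi.single_apply]
            congr 1
            rw [eq_iff_iff]
            exact σ.surjective.injective_comp_right.eq_iff
          rw [h1] at this
          exact this.symm)
        apply e.injective
        simp only [Module.End.smul_def, RingHom.id_apply, hT', LinearEquiv.apply_symm_apply,
          Matrix.mulVec_mulVec, hcomm] }
  obtain ⟨r, hr⟩ := jacobson_density fC
    (Finset.univ.image fun j => e.symm (Pi.single j (1 : K)))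
  refine ⟨r.coeff, fun i j => ?_⟩
  have h := congrArg e (hr (e.symm (Pi.single j (1 : K))) (by simp))
  have h2 := congrFun h i
  simp only [fC, LinearMap.coe_mk, AddHom.coe_mk, LinearEquiv.apply_symm_apply, e,
    Representation.asModuleEquiv_map_smul, Matrix.mulVec_single_one] at h2
  rw [← Matrix.col_apply C, h2, Representation.asAlgebraHom_def, MonoidAlgebra.lift_apply]
  rw [Finsupp.sum_fintype _ _ fun σ => zero_smul K (ρ σ), LinearMap.sum_apply, Finset.sum_apply]
  refine Finset.sum_congr rfl fun σ _ => ?_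
  rw [LinearMap.smul_apply, Pi.smul_apply, smul_eq_mul, ← Pi.single_apply]
  rfl

/-- The trace monomial of a permutation, a product of traces over its cycles, lies in every
subalgebra containing the trace-word functions. -/
theorem cycle_sum_mem {L N : ℕ} {S : Subalgebra ℂ ((Fin L → Matrix (Fin N) (Fin N) ℂ) → ℂ)}
    (hS : ∀ v : List (Fin L), v ≠ [] → pW L N v ∈ S) :
    ∀ {d : ℕ} (σ : Equiv.Perm (Fin d)) (w : Fin d → List (Fin L)), (∀ k, w k ≠ []) →
      (fun X => ∑ i : Fin d → Fin N, ∏ k, wordProd L N X (w k) (i (σ k)) (i k)) ∈ S := by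
  intro d
  induction d with
  | zero =>
    intro σ w _
    convert S.one_mem using 1
    funext X
    simp
  | succ d ih =>
    intro σ w hw
    obtain ⟨⟨x, τ⟩, rfl⟩ := Equiv.Perm.decomposeFin.symm.surjective σ
    induction x using Fin.cases with
    | zero =>
      have h := S.mul_mem (hS (w 0) (hw 0)) (ih τ (fun k => w k.succ) fun k => hw _)
      convert h using 1
      funext X
      rw [← (Fin.consEquiv fun _ => Fin N).sum_comp, Fintype.sum_prod_type]
      simp [Fin.prod_univ_succ, pW, Matrix.trace, Finset.sum_mul_sum]
    | succ y =>
      set z := τ.symm y with hz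
      have h := ih τ (Function.update (fun k => w k.succ) z (w 0 ++ w z.succ)) (by
        intro k
        by_cases hk : k = z
        · subst hk; simp [hw]
        · simp [Function.update_of_ne hk, hw])
      convert h using 1
      funext X
      rw [← (Fin.consEquiv fun _ => Fin N).sum_comp, Fintype.sum_prod_type_right]
      refine Finset.sum_congr rfl fun i _ => ?_
      rw [← Finset.mul_prod_erase _ _ (Finset.mem_univ z)]
      have hτz : τ z = y := by simp [hz]
      have hmul : wordProd L N X (w 0 ++ w z.succ) =
          wordProd L N X (w 0) * wordProd L N X (w z.succ) := by
        simp [wordProd]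
      rw [Function.update_self, hmul, Matrix.mul_apply, hτz, Finset.sum_mul]
      refine Finset.sum_congr rfl fun a _ => ?_
      rw [Fin.prod_univ_succ, ← Finset.mul_prod_erase _ _ (Finset.mem_univ z), ← mul_assoc]
      congr 1
      · simp [hτz, Fin.consEquiv]
      · refine Finset.prod_congr rfl fun k hk => ?_
        have hkz : k ≠ z := (Finset.mem_erase.mp hk).1
        have hne : τ k ≠ y := fun h => hkz (by simp [hz, ← h])
        rw [Function.update_of_ne hkz, Equiv.Perm.decomposeFin_symm_apply_succ,
          Equiv.swap_apply_of_ne_of_ne (Fin.succ_ne_zero _) (by simpa using hne)]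
        simp [Fin.consEquiv]

/-- A matrix commuting with all tensor powers of invertible matrices commutes with every matrix
that is invariant under permutations of the tensor factors. -/
theorem commute_of_commute_tensorPower {K α : Type*} [Field K] [Infinite K] [Fintype α]
    [DecidableEq α] {d : ℕ} {C : Matrix (Fin d → α) (Fin d → α) K}
    (hC : ∀ g : (Matrix α α K)ˣ,
      C * Matrix.of (fun i j => ∏ k, g.1 (i k) (j k)) =
        Matrix.of (fun i j => ∏ k, g.1 (i k) (j k)) * C)
    {B : Matrix (Fin d → α) (Fin d → α) K}
    (hB : ∀ (σ : Equiv.Perm (Fin d)) i j, B (i ∘ σ) (j ∘ σ) = B i j) : C * B = B * C := by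
  ext a b
  let φ : (Fin d → α × α) → K := fun m =>
    C a (Prod.fst ∘ m) * (if Prod.snd ∘ m = b then 1 else 0) -
      (if Prod.fst ∘ m = a then 1 else 0) * C (Prod.snd ∘ m) b
  have key : ∀ B : Matrix (Fin d → α) (Fin d → α) K,
      (C * B) a b - (B * C) a b = ∑ m, φ m * B (Prod.fst ∘ m) (Prod.snd ∘ m) := by
    intro B
    rw [← (Equiv.arrowProdEquivProdArrow (Fin d) (fun _ => α) (fun _ => α)).symm.sum_comp,
      Fintype.sum_prod_type]
    have h1 : ∀ i j : Fin d → α, φ (fun k => (i k, j k)) * B i j =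
        (if j = b then C a i * B i j else 0) - (if i = a then B i j * C j b else 0) := by
      intro i j
      have hi : Prod.fst ∘ (fun k => (i k, j k)) = i := rfl
      have hj : Prod.snd ∘ (fun k => (i k, j k)) = j := rfl
      simp only [φ, hi, hj]
      split_ifs <;> ring
    refine Eq.trans ?_ (Finset.sum_congr rfl fun i _ => Finset.sum_congr rfl fun j _ =>
      (h1 i j).symm)
    simp only [Finset.sum_sub_distrib, Finset.sum_ite_eq', Finset.mem_univ, if_true,
      Matrix.mul_apply]
    congr 1
    rw [Finset.sum_comm]
    simp
  refine sub_eq_zero.mp ((key B).trans ?_)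
  refine sum_mul_eq_zero_of_symmetric (Matrix.det_mvPolynomialX_ne_zero α K) (fun x hx => ?_)
    fun σ m => hB σ (Prod.fst ∘ m) (Prod.snd ∘ m)
  rw [RingHom.map_det, RingHom.mapMatrix_apply] at hx
  have hx' : IsUnit (Matrix.of fun i j => x (i, j)) := by
    rw [Matrix.isUnit_iff_isUnit_det, isUnit_iff_ne_zero]
    convert hx using 2
    ext i j
    simp [Matrix.mvPolynomialX]
  obtain ⟨g, hg⟩ := hx'
  have := key (Matrix.of fun i j => ∏ k, g.1 (i k) (j k))
  rw [hC g, sub_self] at this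
  rw [this]
  simp [hg]

/-- Multilinear invariants of tuples of matrices are combinations of the trace monomials
indexed by permutations. -/
theorem exists_perm_coeff_of_conj_invariant {K α : Type*} [Field K] [CharZero K] [Fintype α]
    [DecidableEq α] {d : ℕ} (H : MultilinearMap K (fun _ : Fin d => Matrix α α K) K)
    (hH : ∀ (g : (Matrix α α K)ˣ) Z, H (fun k => g.1 * Z k * g⁻¹.1) = H Z) :
    ∃ c : Equiv.Perm (Fin d) → K, ∀ Z : Fin d → Matrix α α K,
      H Z = ∑ σ, c σ * ∑ i : Fin d → α, ∏ k, Z k (i (σ k)) (i k) := by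
  let C : Matrix (Fin d → α) (Fin d → α) K :=
    Matrix.of fun i j => H fun k => Matrix.single (j k) (i k) 1
  have hH' : ∀ (g : (Matrix α α K)ˣ) (Z : Fin d → Matrix α α K),
      H (fun k => g.1 * Z k) = H (fun k => Z k * g.1) := by
    intro g Z
    rw [← hH g fun k => Z k * g.1]
    simp [mul_assoc]
  have hCg : ∀ g : (Matrix α α K)ˣ,
      C * Matrix.of (fun i j => ∏ k, g.1 (i k) (j k)) =
        Matrix.of (fun i j => ∏ k, g.1 (i k) (j k)) * C := by
    intro g
    ext j i
    have h1 : ∀ k, g.1 * Matrix.single (i k) (j k) 1 =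
        ∑ l, g.1 l (i k) • Matrix.single l (j k) (1 : K) := by
      intro k
      ext a b
      simp [Matrix.mul_apply, Matrix.sum_apply, Matrix.single_apply, ite_and]
    have h2 : ∀ k, Matrix.single (i k) (j k) 1 * g.1 =
        ∑ l, g.1 (j k) l • Matrix.single (i k) l (1 : K) := by
      intro k
      ext a b
      simp [Matrix.mul_apply, Matrix.sum_apply, Matrix.single_apply, ite_and]
    have h := hH' g fun k => Matrix.single (i k) (j k) 1
    simp_rw [h1, h2, H.map_sum] at h
    simp_rw [H.map_smul_univ (fun k => g.1 _ _)] at h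
    simpa [Matrix.mul_apply, C, mul_comm] using h
  obtain ⟨c, hc⟩ := exists_perm_coeff_of_commute fun B hB => commute_of_commute_tensorPower hCg hB
  refine ⟨c, fun Z => ?_⟩
  have hZ : Z = fun k => ∑ p : α × α, Z k p.1 p.2 • Matrix.single p.1 p.2 (1 : K) := by
    funext k
    conv_lhs => rw [Matrix.matrix_eq_sum_single (Z k)]
    rw [Fintype.sum_prod_type]
    simp
  have hexp : H Z = ∑ j : Fin d → α, ∑ i : Fin d → α, C j i * ∏ k, Z k (i k) (j k) := by
    conv_lhs => rw [hZ, H.map_sum]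
    rw [← (Equiv.arrowProdEquivProdArrow (Fin d) (fun _ => α) (fun _ => α)).symm.sum_comp,
      Fintype.sum_prod_type_right]
    refine Finset.sum_congr rfl fun j _ => Finset.sum_congr rfl fun i _ => ?_
    rw [H.map_smul_univ (fun k => Z k _ _), smul_eq_mul, mul_comm]
    rfl
  have hsum : ∀ j : Fin d → α, ∑ i : Fin d → α, C j i * ∏ k, Z k (i k) (j k) =
      ∑ σ, c σ * ∏ k, Z k (j (σ k)) (j k) := by
    intro j
    simp_rw [hc, Finset.sum_mul]
    rw [Finset.sum_comm]
    refine Finset.sum_congr rfl fun σ _ => ?_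
    simp
  simp_rw [hexp, hsum, Finset.mul_sum]
  exact Finset.sum_comm

/-- Polarization for multilinear forms on a finite-dimensional space. -/
theorem MultilinearMap.sum_perm_eq_zero_of_diagonal_of_finite {K M : Type*} [Field K] [Infinite K]
    [AddCommGroup M] [Module K M] [Module.Finite K M] {d : ℕ}
    (F : MultilinearMap K (fun _ : Fin d => M) K)
    (hF : ∀ x, F (fun _ => x) = 0) (Y : Fin d → M) :
    ∑ σ : Equiv.Perm (Fin d), F (fun k => Y (σ k)) = 0 := by
  let e := (Module.finBasis K M).equivFun
  simpa using (F.compLinearMap fun _ => e.symm.toLinearMap).sum_perm_eq_zero_of_diagonal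
    (fun x => hF (e.symm x)) fun k => e (Y k)

/-- Simultaneous conjugation of a tuple of matrices. -/
def conjTuple (L N : ℕ) (g : (Matrix (Fin N) (Fin N) ℂ)ˣ) :
    (Fin L → Matrix (Fin N) (Fin N) ℂ) →ₗ[ℂ] (Fin L → Matrix (Fin N) (Fin N) ℂ) where
  toFun X := fun α => g.1 * X α * g⁻¹.1
  map_add' X Y := by ext1 α; simp [mul_add, add_mul]
  map_smul' c X := by ext1 α; simp

/-- Listing the entries of a tuple of matrices. -/
def entryTuple (L N : ℕ) :
    (Fin L → Matrix (Fin N) (Fin N) ℂ) →ₗ[ℂ] (Fin L × Fin N × Fin N → ℂ) where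
  toFun X := fun q => X q.1 q.2.1 q.2.2
  map_add' _ _ := rfl
  map_smul' _ _ := rfl

/-- A form given by a multilinear map whose diagonal is conjugation invariant lies in every
subalgebra containing the trace-word functions. -/
theorem diagonal_mem_of_conj_invariant {L N d : ℕ}
    {S : Subalgebra ℂ ((Fin L → Matrix (Fin N) (Fin N) ℂ) → ℂ)}
    (hS : ∀ v : List (Fin L), v ≠ [] → pW L N v ∈ S)
    (F : MultilinearMap ℂ (fun _ : Fin d => Fin L → Matrix (Fin N) (Fin N) ℂ) ℂ)
    (hF : ∀ g X, F (fun _ => conjTuple L N g X) = F fun _ => X) :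
    (fun X => F fun _ => X) ∈ S := by
  let G := ∑ σ : Equiv.Perm (Fin d), F.domDomCongr σ
  have hG : ∀ Y, G Y = ∑ σ : Equiv.Perm (Fin d), F fun k => Y (σ k) := by
    intro Y
    simp [G]
  have hGinv : ∀ g Y, G (fun k => conjTuple L N g (Y k)) = G Y := by
    intro g Y
    have := (F.compLinearMap (fun _ => conjTuple L N g) - F).sum_perm_eq_zero_of_diagonal_of_finite
      (fun X => by simp [hF]) Y
    simpa [hG, sub_eq_zero] using this
  let H := fun a : Fin d → Fin L =>
    G.compLinearMap fun k => LinearMap.single ℂ (fun _ => Matrix (Fin N) (Fin N) ℂ) (a k)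
  have hH : ∀ a (g : (Matrix (Fin N) (Fin N) ℂ)ˣ) Z,
      H a (fun k => g.1 * Z k * g⁻¹.1) = H a Z := by
    intro a g Z
    simp only [H, MultilinearMap.compLinearMap_apply]
    refine Eq.trans ?_ (hGinv g _)
    congr 1
    funext k α
    by_cases h : α = a k
    · subst h; simp [conjTuple]
    · simp [conjTuple, h]
  choose c hc using fun a => exists_perm_coeff_of_conj_invariant (H a) (hH a)
  have hGX : ∀ X, G (fun _ => X) = ∑ a : Fin d → Fin L, H a fun k => X (a k) := by
    intro X
    have hX : X = ∑ α, LinearMap.single ℂ (fun _ => Matrix (Fin N) (Fin N) ℂ) α (X α) := by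
      simp [Finset.univ_sum_single]
    conv_lhs => rw [hX, G.map_sum]
    rfl
  have hfac : (d.factorial : ℂ) ≠ 0 := by exact_mod_cast d.factorial_ne_zero
  have hFX : (fun X => F fun _ => X) = (d.factorial : ℂ)⁻¹ • ∑ a : Fin d → Fin L, ∑ σ, c a σ •
      fun X => ∑ i : Fin d → Fin N, ∏ k, wordProd L N X [a k] (i (σ k)) (i k) := by
    funext X
    have h : (d.factorial : ℂ) * F (fun _ => X) = ∑ a : Fin d → Fin L, H a fun k => X (a k) := by
      rw [← hGX, hG]
      simp [Fintype.card_perm]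
    simp_rw [hc] at h
    rw [Pi.smul_apply, smul_eq_mul, eq_inv_mul_iff_mul_eq₀ hfac, h]
    simp [Finset.sum_apply, wordProd]
  rw [hFX]
  exact S.smul_mem (S.sum_mem fun a _ => S.sum_mem fun σ _ =>
    S.smul_mem (cycle_sum_mem hS σ (fun k => [a k]) fun k => by simp) _) _

/-- first fundamental theorem of invariant theory, after Procesi.
Let `f : (Mat(N,ℂ))^L → ℂ` be a polynomial function invariant under simultaneous
conjugation by every invertible matrix `g ∈ GL(N,ℂ)`.  Then `f` belongs to the unital
`ℂ`-subalgebra generated by the trace-word functions `p_{w;N}`, `w ∈ W_L`. -/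
theorem stmt7 (L N : ℕ) (hL : 1 ≤ L)
    (f : (Fin L → Matrix (Fin N) (Fin N) ℂ) → ℂ)
    (hpoly : IsPolyFun L N f)
    (hinv : ∀ g : (Matrix (Fin N) (Fin N) ℂ)ˣ,
      ∀ X : Fin L → Matrix (Fin N) (Fin N) ℂ,
        f (fun α => (g : Matrix (Fin N) (Fin N) ℂ) * X α *
          ((g⁻¹ : (Matrix (Fin N) (Fin N) ℂ)ˣ) : Matrix (Fin N) (Fin N) ℂ)) = f X) :
    f ∈ Algebra.adjoin ℂ {p | ∃ v : List (Fin L), v ≠ [] ∧ p = pW L N v} := by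
  obtain ⟨P, hP⟩ := hpoly
  choose F₀ hF₀ using fun d =>
    (MvPolynomial.homogeneousComponent_isHomogeneous d P).exists_multilinearMap
  let F := fun d => (F₀ d).compLinearMap fun _ => entryTuple L N
  set n := P.totalDegree + 1
  have hf : ∀ X, f X = ∑ d ∈ Finset.range n, F d fun _ => X := by
    intro X
    rw [hP]
    conv_lhs => rw [← MvPolynomial.sum_homogeneousComponent P, map_sum]
    exact Finset.sum_congr rfl fun d _ => (hF₀ d _).symm
  have hFinv : ∀ d ∈ Finset.range n, ∀ g X,
      F d (fun _ => conjTuple L N g X) = F d fun _ => X := by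
    intro d hd g X
    let p : Polynomial ℂ := ∑ d ∈ Finset.range n,
      Polynomial.monomial d (F d (fun _ => conjTuple L N g X) - F d fun _ => X)
    have hsmul : ∀ d (t : ℂ) Y, F d (fun _ => t • Y) = t ^ d * F d fun _ => Y := by
      intro d t Y
      rw [(F d).map_smul_univ (fun _ => t) (fun _ => Y)]
      simp
    have hp : p = 0 := by
      refine Polynomial.funext fun t => ?_
      have h := hinv g (t • X)
      change f (conjTuple L N g (t • X)) = _ at h
      rw [map_smul, hf, hf, ← sub_eq_zero, ← Finset.sum_sub_distrib] at h
      simp_rw [hsmul] at h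
      rw [Polynomial.eval_finsetSum, Polynomial.eval_zero, ← h]
      refine Finset.sum_congr rfl fun d _ => ?_
      rw [Polynomial.eval_monomial]
      ring
    have := congrArg (fun p => Polynomial.coeff p d) hp
    simp only [p, Polynomial.finsetSum_coeff, Polynomial.coeff_monomial, Polynomial.coeff_zero,
      Finset.sum_ite_eq', hd, if_true] at this
    exact sub_eq_zero.mp this
  have hfsum : f = ∑ d ∈ Finset.range n, fun X => F d fun _ => X := by
    funext X
    rw [hf, Finset.sum_apply]
  rw [hfsum]
  refine Subalgebra.sum_mem _ fun d hd => diagonal_mem_of_conj_invariant ?_ (F d) (hFinv d hd)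
  exact fun v hv => Algebra.subset_adjoin ⟨v, hv, rfl⟩
end
end

section
/- Let 1 ≤ d < N and let f : (Mat(N,ℂ))^L → ℂ be a polynomial function such that f(gX₁g^{−1},…,gX_Lg^{−1}) = f(X₁,…,X_L) for every block-diagonal matrix g = diag(1_d, h) with h ∈ GL(N−d,ℂ) and all X₁,…,X_L ∈ Mat(N,ℂ). Then f belongs to the unital ℂ-subalgebra of the algebra of functions (Mat(N,ℂ))^L → ℂ generated by the trace-word functions p_{w;N} (w ∈ W_L) together with the matrix-entry functions p_{ij;w;N} (w ∈ W_L, 1 ≤ i,j ≤ d). -/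
noncomputable section

theorem sum_perm_prod_eq_sum_compl {n : ℕ} (A : Fin n → Fin n → ℂ) :
    ∑ σ : Equiv.Perm (Fin n), ∏ k, A k (σ k) =
      ∑ U : Finset (Fin n), (-1) ^ U.card * ∏ k, ∑ l ∈ Uᶜ, A k l := by
  have key : ∀ p : Fin n → Fin n,
      ∑ U : Finset (Fin n), (if ∀ k, p k ∈ Uᶜ then (-1 : ℂ) ^ U.card else 0) =
        if Function.Bijective p then 1 else 0 := by
    intro p
    have h1 : (Finset.univ.filter fun U : Finset (Fin n) => ∀ k, p k ∈ Uᶜ) =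
        ((Finset.univ.image p)ᶜ).powerset := by
      ext U
      simp only [Finset.mem_filter, Finset.mem_univ, true_and, Finset.mem_compl,
        Finset.mem_powerset, Finset.subset_iff, Finset.mem_image, not_exists]
      exact ⟨fun h x hx k hk => h k (hk ▸ hx), fun h k hk => h hk k rfl⟩
    have h2 := Finset.sum_powerset_neg_one_pow_card (x := (Finset.univ.image p)ᶜ)
    have h3 : ((Finset.univ.image p)ᶜ = ∅) ↔ Function.Bijective p := by
      rw [Finset.compl_eq_empty_iff, ← Finite.surjective_iff_bijective, Finset.eq_univ_iff_forall]
      simp [Function.Surjective]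
    rw [← Finset.sum_filter, h1]
    simp only [h3] at h2
    exact_mod_cast congrArg (Int.cast : ℤ → ℂ) h2
  have h4 : ∀ U : Finset (Fin n), ∏ k, ∑ l ∈ Uᶜ, A k l =
      ∑ p : Fin n → Fin n, if ∀ k, p k ∈ Uᶜ then ∏ k, A k (p k) else 0 := by
    intro U
    rw [Finset.prod_univ_sum, ← Finset.sum_filter]
    refine Finset.sum_congr ?_ fun _ _ => rfl
    ext p
    simp [Fintype.mem_piFinset]
  calc _ = ∑ p : Fin n → Fin n, (if Function.Bijective p then 1 else 0) * ∏ k, A k (p k) := by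
        simp only [ite_mul, one_mul, zero_mul]
        rw [← Finset.sum_filter]
        refine Finset.sum_bij (fun σ _ => ⇑σ) (fun σ _ => Finset.mem_filter.2 ⟨Finset.mem_univ _, σ.bijective⟩)
          (fun σ _ τ _ h => DFunLike.coe_injective h) (fun p hp => ?_) fun _ _ => rfl
        exact ⟨Equiv.ofBijective p (Finset.mem_filter.1 hp).2, Finset.mem_univ _, rfl⟩
    _ = _ := by
        simp only [← key, h4, Finset.sum_mul, Finset.mul_sum, ite_mul, mul_ite, zero_mul, mul_zero]
        exact Finset.sum_comm

section Bicommutant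

variable {ι : Type*} [Fintype ι] [DecidableEq ι]

/-- The `(j, k)` block of a linear endomorphism of matrices, acting on columns. -/
def columnBlock (π : Matrix ι ι ℂ →ₗ[ℂ] Matrix ι ι ℂ) (j k : ι) : Matrix ι ι ℂ :=
  Matrix.of fun i l => π (Matrix.single l k 1) i j

theorem apply_eq_sum_columnBlock (π : Matrix ι ι ℂ →ₗ[ℂ] Matrix ι ι ℂ) (Y : Matrix ι ι ℂ)
    (i j : ι) : π Y i j = ∑ k, (columnBlock π j k * Y) i k := by
  conv_lhs => rw [Matrix.matrix_eq_sum_single Y]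
  rw [Finset.sum_comm]
  simp only [map_sum, Matrix.sum_apply, Matrix.mul_apply, columnBlock, Matrix.of_apply]
  refine Finset.sum_congr rfl fun k _ => Finset.sum_congr rfl fun l _ => ?_
  have : Matrix.single l k (Y l k) = Y l k • Matrix.single l k (1 : ℂ) := by simp
  rw [this, map_smul, Matrix.smul_apply, smul_eq_mul, mul_comm]

theorem columnBlock_mul (π : Matrix ι ι ℂ →ₗ[ℂ] Matrix ι ι ℂ) (s : Matrix ι ι ℂ) (j k i l : ι) :
    (columnBlock π j k * s) i l = π (s * Matrix.single l k 1) i j := by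
  rw [apply_eq_sum_columnBlock, Finset.sum_eq_single k]
  · simp [← Matrix.mul_assoc]
  · intro m _ hm
    simp [← Matrix.mul_assoc, hm]
  · simp

theorem mul_columnBlock (π : Matrix ι ι ℂ →ₗ[ℂ] Matrix ι ι ℂ) (s : Matrix ι ι ℂ) (j k i l : ι) :
    (s * columnBlock π j k) i l = (s * π (Matrix.single l k 1)) i j := by
  simp [Matrix.mul_apply, columnBlock]

theorem map_mul_of_commute_columnBlock (π : Matrix ι ι ℂ →ₗ[ℂ] Matrix ι ι ℂ) (T : Matrix ι ι ℂ)
    (h : ∀ j k, T * columnBlock π j k = columnBlock π j k * T) (Y : Matrix ι ι ℂ) :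
    π (T * Y) = T * π Y := by
  ext i j
  rw [apply_eq_sum_columnBlock]
  simp only [← Matrix.mul_assoc, ← h]
  rw [Matrix.mul_apply]
  simp only [Matrix.mul_assoc, apply_eq_sum_columnBlock π Y, Finset.mul_sum]
  rw [Finset.sum_comm]
  exact Finset.sum_congr rfl fun k _ => Matrix.mul_apply

/-- There is a linear projection onto the span of a star-closed monoid of matrices which commutes
with left multiplication by the monoid. -/
theorem exists_projection_span (S : Submonoid (Matrix ι ι ℂ))
    (hstar : ∀ s ∈ S, s.conjTranspose ∈ S) :
    ∃ π : Matrix ι ι ℂ →ₗ[ℂ] Matrix ι ι ℂ, (∀ Y, π Y ∈ Submodule.span ℂ (S : Set (Matrix ι ι ℂ))) ∧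
      π 1 = 1 ∧ ∀ s ∈ S, ∀ Y, π (s * Y) = s * π Y := by
  let e : Matrix ι ι ℂ ≃ₗ[ℂ] EuclideanSpace ℂ (ι × ι) :=
    (LinearEquiv.curry ℂ ℂ ι ι).symm.trans (WithLp.linearEquiv 2 ℂ (ι × ι → ℂ)).symm
  have he : ∀ (Y : Matrix ι ι ℂ) i j, e Y (i, j) = Y i j := fun Y i j => rfl
  have hin : ∀ X Y : Matrix ι ι ℂ, inner ℂ (e X) (e Y) = (X.conjTranspose * Y).trace := by
    intro X Y
    rw [PiLp.inner_apply, Fintype.sum_prod_type, Finset.sum_comm]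
    simp [he, Matrix.trace, Matrix.mul_apply, mul_comm]
  set A := Submodule.span ℂ (S : Set (Matrix ι ι ℂ)) with hA
  let K := A.map e.toLinearMap
  have hmul : ∀ s ∈ S, ∀ a ∈ A, s * a ∈ A := by
    intro s hs a ha
    induction ha using Submodule.span_induction with
    | mem x hx => exact Submodule.subset_span (S.mul_mem hs hx)
    | zero => simp
    | add x y _ _ hx hy => rw [mul_add]; exact A.add_mem hx hy
    | smul c x _ hx => rw [mul_smul_comm]; exact A.smul_mem c hx
  have hKmem : ∀ Y, e Y ∈ K ↔ Y ∈ A := fun Y => by simp [K]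
  let π : Matrix ι ι ℂ →ₗ[ℂ] Matrix ι ι ℂ :=
    e.symm.toLinearMap ∘ₗ K.starProjection.toLinearMap ∘ₗ e.toLinearMap
  have hπ : ∀ Y, e (π Y) = K.starProjection (e Y) := fun Y => by simp [π]
  refine ⟨π, fun Y => ?_, ?_, fun s hs Y => ?_⟩
  · rw [← hKmem, hπ]; exact K.starProjection_apply_mem _
  · apply e.injective
    rw [hπ, Submodule.starProjection_eq_self_iff, hKmem]
    exact Submodule.subset_span S.one_mem
  · apply e.injective
    rw [hπ]
    refine Submodule.eq_starProjection_of_mem_of_inner_eq_zero ?_ ?_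
    · rw [hKmem]
      refine hmul s hs _ ?_
      rw [← hKmem, hπ]; exact K.starProjection_apply_mem _
    · intro w hw
      obtain ⟨a, ha, rfl⟩ := hw
      have h1 : inner ℂ (e (Y - π Y)) (e (s.conjTranspose * a)) = 0 := by
        rw [map_sub, hπ]
        exact Submodule.starProjection_inner_eq_zero _ _
          ((hKmem _).2 (hmul _ (hstar s hs) a ha))
      rw [hin] at h1
      rw [← map_sub, ← mul_sub]
      change inner ℂ _ (e a) = 0
      rw [hin, Matrix.conjTranspose_mul, Matrix.mul_assoc]
      exact h1

/-- A finite-dimensional double commutant theorem. -/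
theorem mem_span_of_commute_commutant (S : Submonoid (Matrix ι ι ℂ))
    (hstar : ∀ s ∈ S, s.conjTranspose ∈ S) (T : Matrix ι ι ℂ)
    (hT : ∀ b : Matrix ι ι ℂ, (∀ s ∈ S, s * b = b * s) → T * b = b * T) :
    T ∈ Submodule.span ℂ (S : Set (Matrix ι ι ℂ)) := by
  obtain ⟨π, hmem, h1, hcomm⟩ := exists_projection_span S hstar
  have h := map_mul_of_commute_columnBlock π T (fun j k => hT _ fun s hs => by
    ext i l
    rw [mul_columnBlock, columnBlock_mul, hcomm s hs]) 1
  rw [h1, mul_one] at h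
  exact h ▸ hmem T

end Bicommutant

section Tensor

variable {R : Type*} [CommRing R] {n N : ℕ}

/-- The matrix of the operator `⊗ₖ gₖ` followed by the permutation `σ` of tensor factors. -/
def permTensor (σ : Equiv.Perm (Fin n)) (g : Fin n → Matrix (Fin N) (Fin N) R) :
    Matrix (Fin n → Fin N) (Fin n → Fin N) R :=
  Matrix.of fun I J => ∏ k, g k (I k) (J (σ k))

theorem permTensor_mul (σ τ : Equiv.Perm (Fin n)) (g h : Fin n → Matrix (Fin N) (Fin N) R) :
    permTensor σ g * permTensor τ h = permTensor (τ * σ) fun k => g k * h (σ k) := by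
  ext I K
  simp only [permTensor, Matrix.mul_apply, Matrix.of_apply, Equiv.Perm.mul_apply]
  rw [Finset.prod_univ_sum, Fintype.piFinset_univ]
  rw [← Equiv.sum_comp (Equiv.arrowCongr σ (Equiv.refl (Fin N)))]
  refine Finset.sum_congr rfl fun J _ => ?_
  rw [← Equiv.prod_comp σ fun k => h k _ _, ← Finset.prod_mul_distrib]
  simp

theorem permTensor_one : permTensor 1 (fun _ : Fin n => (1 : Matrix (Fin N) (Fin N) R)) = 1 := by
  ext I J
  simp only [permTensor, Matrix.of_apply, Matrix.one_apply]
  rw [Finset.prod_ite_zero]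
  simp [funext_iff]

theorem conjTranspose_permTensor (σ : Equiv.Perm (Fin n))
    (g : Fin n → Matrix (Fin N) (Fin N) ℂ) :
    (permTensor σ g).conjTranspose = permTensor σ⁻¹ fun k => (g (σ⁻¹ k)).conjTranspose := by
  ext I J
  simp only [permTensor, Matrix.conjTranspose_apply, Matrix.of_apply, star_prod]
  exact Fintype.prod_equiv σ _ _ fun k => by simp

theorem permTensor_single (I J : Fin n → Fin N) :
    permTensor 1 (fun k => Matrix.single (I k) (J k) (1 : R)) = Matrix.single I J 1 := by
  ext I' J'
  simp only [permTensor, Matrix.of_apply, Matrix.single_apply, Equiv.Perm.one_apply]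
  rw [Finset.prod_ite_zero]
  simp [funext_iff, forall_and]

theorem permTensor_one_sum {κ : Type*} [Fintype κ] (Z : Fin n → κ → Matrix (Fin N) (Fin N) R) :
    permTensor 1 (fun k => ∑ a, Z k a) = ∑ a : Fin n → κ, permTensor 1 fun k => Z k (a k) := by
  ext I J
  simp only [permTensor, Matrix.sum_apply, Matrix.of_apply]
  rw [Finset.prod_univ_sum, Fintype.piFinset_univ]

theorem permTensor_smul (c : R) (g : Fin n → Matrix (Fin N) (Fin N) R) :
    permTensor 1 (fun k => c • g k) = c ^ n • permTensor 1 g := by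
  ext I J
  simp [permTensor, Finset.prod_mul_distrib]

/-- The submonoid of permutations composed with tensor products of elements of `K`. -/
def permTensorSubmonoid (n : ℕ) (K : Submonoid (Matrix (Fin N) (Fin N) R)) :
    Submonoid (Matrix (Fin n → Fin N) (Fin n → Fin N) R) where
  carrier := {s | ∃ σ g, (∀ k, g k ∈ K) ∧ s = permTensor σ g}
  one_mem' := ⟨1, fun _ => 1, fun _ => K.one_mem, permTensor_one.symm⟩
  mul_mem' := by
    rintro _ _ ⟨σ, g, hg, rfl⟩ ⟨τ, h, hh, rfl⟩
    exact ⟨_, _, fun k => K.mul_mem (hg k) (hh _), permTensor_mul σ τ g h⟩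

/-- A trace of a permuted tensor product is a product of traces over the cycles. -/
theorem sum_prod_perm_mem (B : Subring R) (M : Subsemigroup (Matrix (Fin N) (Fin N) R))
    (htr : ∀ m ∈ M, m.trace ∈ B) : ∀ (n : ℕ) (σ : Equiv.Perm (Fin n))
    (Y : Fin n → Matrix (Fin N) (Fin N) R), (∀ k, Y k ∈ M) →
    ∑ I : Fin n → Fin N, ∏ k, Y k (I k) (I (σ k)) ∈ B := by
  intro n
  induction n with
  | zero => intro σ Y _; simp
  | succ n ih =>
    intro σ Y hY
    obtain ⟨⟨p, τ⟩, rfl⟩ := Equiv.Perm.decomposeFin.symm.surjective σ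
    rw [← Equiv.sum_comp (Fin.consEquiv fun _ => Fin N), Fintype.sum_prod_type]
    simp only [Fin.consEquiv_apply, Fin.prod_univ_succ, Fin.cons_zero, Fin.cons_succ,
      Equiv.Perm.decomposeFin_symm_apply_zero, Equiv.Perm.decomposeFin_symm_apply_succ]
    induction p using Fin.cases with
    | zero =>
      simp only [Equiv.swap_self, Equiv.refl_apply, Fin.cons_zero, Fin.cons_succ, ← Finset.mul_sum,
        ← Finset.sum_mul]
      exact B.mul_mem (htr _ (hY 0)) (ih τ (fun k => Y k.succ) fun k => hY _)
    | succ a =>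
      have key := ih τ (Function.update (fun k => Y k.succ) (τ.symm a)
        (Y (τ.symm a).succ * Y 0)) (fun k => by
          by_cases hk : k = τ.symm a
          · subst hk; rw [Function.update_self]; exact M.mul_mem (hY _) (hY _)
          · simpa [hk] using hY _)
      convert key using 1
      rw [Finset.sum_comm]
      refine Finset.sum_congr rfl fun I _ => ?_
      rw [← Finset.mul_prod_erase Finset.univ _ (Finset.mem_univ (τ.symm a))]
      simp only [Function.update_self, Matrix.mul_apply, Finset.sum_mul, Equiv.apply_symm_apply]
      refine Finset.sum_congr rfl fun s _ => ?_
      rw [← Finset.mul_prod_erase Finset.univ _ (Finset.mem_univ (τ.symm a))]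
      simp only [Fin.cons_succ, Equiv.apply_symm_apply, Equiv.swap_apply_right, Fin.cons_zero]
      have : ∀ k ∈ Finset.univ.erase (τ.symm a),
          Y k.succ (I k) ((Fin.cons s I : Fin (n + 1) → Fin N)
            (Equiv.swap 0 a.succ (τ k).succ)) =
          Function.update (fun k => Y k.succ) (τ.symm a) (Y (τ.symm a).succ * Y 0) k
            (I k) (I (τ k)) := by
        intro k hk
        have hk' : k ≠ τ.symm a := Finset.ne_of_mem_erase hk
        have h2 : τ k ≠ a := fun h => hk' (by simp [← h])
        rw [Equiv.swap_apply_of_ne_of_ne (Fin.succ_ne_zero _) (by simpa using h2)]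
        simp [hk']
      rw [Finset.prod_congr rfl this]
      ring

end Tensor

section Generic

variable {R : Type*} [CommRing R] {L N : ℕ}

/-- The matrices spanned, over a subring `B` of the coefficients, by words in the matrices `x`
and by products `x_u E_{ij} x_v` of words with matrix units with `i, j < d`. -/
def wordSpan (d : ℕ) (B : Subring R) (x : Fin L → Matrix (Fin N) (Fin N) R) :
    Submodule B (Matrix (Fin N) (Fin N) R) :=
  Submodule.span B
    ({m | ∃ u : List (Fin L), m = (u.map x).prod} ∪
      {m | ∃ (u v : List (Fin L)) (i j : Fin N), (i : ℕ) < d ∧ (j : ℕ) < d ∧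
        m = (u.map x).prod * Matrix.single i j 1 * (v.map x).prod})

variable {d : ℕ} {B : Subring R} {x : Fin L → Matrix (Fin N) (Fin N) R}

theorem entry_word_mem
    (hentry : ∀ (w : List (Fin L)) (i j : Fin N), w ≠ [] → (i : ℕ) < d → (j : ℕ) < d →
      (w.map x).prod i j ∈ B) (w : List (Fin L)) (i j : Fin N) (hi : (i : ℕ) < d)
    (hj : (j : ℕ) < d) : (w.map x).prod i j ∈ B := by
  by_cases hw : w = []
  · subst hw
    simp only [List.map_nil, List.prod_nil, Matrix.one_apply]
    split_ifs
    exacts [B.one_mem, B.zero_mem]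
  · exact hentry w i j hw hi hj

theorem single_mul_mul_single (M : Matrix (Fin N) (Fin N) R) (i j k l : Fin N) :
    Matrix.single i j 1 * M * Matrix.single k l 1 = M j k • Matrix.single i l (1 : R) := by
  rw [Matrix.single_mul_mul_single]
  simp

theorem mul_mem_wordSpan
    (hentry : ∀ (w : List (Fin L)) (i j : Fin N), w ≠ [] → (i : ℕ) < d → (j : ℕ) < d →
      (w.map x).prod i j ∈ B) {m m' : Matrix (Fin N) (Fin N) R}
    (hm : m ∈ wordSpan d B x) (hm' : m' ∈ wordSpan d B x) : m * m' ∈ wordSpan d B x := by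
  unfold wordSpan at hm hm'
  induction hm using Submodule.span_induction with
  | zero => simp
  | add a b _ _ ha hb => rw [add_mul]; exact add_mem ha hb
  | smul c a _ ha => rw [smul_mul_assoc]; exact Submodule.smul_mem _ c ha
  | mem a ha =>
    induction hm' using Submodule.span_induction with
    | zero => simp
    | add a b _ _ ha hb => rw [mul_add]; exact add_mem ha hb
    | smul c a _ ha => rw [mul_smul_comm]; exact Submodule.smul_mem _ c ha
    | mem b hb =>
      rcases ha with ⟨u, rfl⟩ | ⟨u, v, i, j, hi, hj, rfl⟩ <;>
        rcases hb with ⟨u', rfl⟩ | ⟨u', v', k, l, hk, hl, rfl⟩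
      · exact Submodule.subset_span (Or.inl ⟨u ++ u', by simp⟩)
      · exact Submodule.subset_span
          (Or.inr ⟨u ++ u', v', k, l, hk, hl, by simp [Matrix.mul_assoc]⟩)
      · exact Submodule.subset_span
          (Or.inr ⟨u, v ++ u', i, j, hi, hj, by simp [Matrix.mul_assoc]⟩)
      · have h := Submodule.smul_mem (wordSpan d B x)
          (⟨_, entry_word_mem hentry (v ++ u') j k hj hk⟩ : B)
          (Submodule.subset_span (Or.inr ⟨u, v', i, l, hi, hl, rfl⟩))
        convert h using 1
        rw [Subring.smul_def]
        have h2 := single_mul_mul_single ((v ++ u').map x).prod i j k l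
        calc _ = (u.map x).prod * (Matrix.single i j 1 * ((v ++ u').map x).prod *
              Matrix.single k l 1) * (v'.map x).prod := by
              simp [Matrix.mul_assoc]
          _ = _ := by rw [h2, mul_smul_comm, smul_mul_assoc]

theorem trace_mem_of_mem_wordSpan
    (htrace : ∀ w : List (Fin L), w ≠ [] → (w.map x).prod.trace ∈ B)
    (hentry : ∀ (w : List (Fin L)) (i j : Fin N), w ≠ [] → (i : ℕ) < d → (j : ℕ) < d →
      (w.map x).prod i j ∈ B) {m : Matrix (Fin N) (Fin N) R}
    (hm : m ∈ wordSpan d B x) : m.trace ∈ B := by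
  unfold wordSpan at hm
  induction hm using Submodule.span_induction with
  | zero => simp
  | add a b _ _ ha hb => rw [Matrix.trace_add]; exact add_mem ha hb
  | smul c a _ ha =>
    rw [Subring.smul_def, Matrix.trace_smul]; exact B.mul_mem c.2 ha
  | mem a ha =>
    rcases ha with ⟨u, rfl⟩ | ⟨u, v, i, j, hi, hj, rfl⟩
    · by_cases hu : u = []
      · subst hu; simp
      · exact htrace u hu
    · rw [Matrix.trace_mul_comm, ← Matrix.mul_assoc, ← List.prod_append, ← List.map_append,
        Matrix.trace_mul_comm, Matrix.trace_single_mul, one_smul]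
      exact entry_word_mem hentry _ _ _ hj hi

theorem letter_mem_wordSpan (α : Fin L) : x α ∈ wordSpan d B x :=
  Submodule.subset_span (Or.inl ⟨[α], by simp⟩)

end Generic

/-- Matrices which agree with a scalar matrix outside the upper left `d × d` block. -/
def cornerSubmonoid (N d : ℕ) : Submonoid (Matrix (Fin N) (Fin N) ℂ) where
  carrier := {g | ∃ c : ℂ, ∀ i j : Fin N, (d ≤ i ∨ d ≤ j) → g i j = if i = j then c else 0}
  one_mem' := ⟨1, fun i j _ => Matrix.one_apply⟩
  mul_mem' := by
    rintro g h ⟨a, ha⟩ ⟨b, hb⟩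
    refine ⟨a * b, fun i j hij => ?_⟩
    rw [Matrix.mul_apply]
    rcases hij with hi | hj
    · simp only [ha i _ (Or.inl hi), ite_mul, zero_mul, Finset.sum_ite_eq, Finset.mem_univ,
        if_true, hb i j (Or.inl hi), mul_ite, mul_zero]
    · simp only [hb _ j (Or.inr hj), mul_ite, mul_zero, Finset.sum_ite_eq', Finset.mem_univ,
        if_true, ha i j (Or.inr hj), ite_mul, zero_mul]

theorem conjTranspose_mem_cornerSubmonoid {N d : ℕ} {g : Matrix (Fin N) (Fin N) ℂ}
    (hg : g ∈ cornerSubmonoid N d) : g.conjTranspose ∈ cornerSubmonoid N d := by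
  obtain ⟨c, hc⟩ := hg
  refine ⟨star c, fun i j hij => ?_⟩
  rw [Matrix.conjTranspose_apply, hc j i hij.symm]
  by_cases h : i = j
  · simp [h]
  · simp [h, Ne.symm h]

theorem map_mem_wordSpan_of_mem_cornerSubmonoid {R : Type*} [CommRing R] [Algebra ℂ R]
    {L N d : ℕ} (B : Subalgebra ℂ R) (x : Fin L → Matrix (Fin N) (Fin N) R)
    {g : Matrix (Fin N) (Fin N) ℂ} (hg : g ∈ cornerSubmonoid N d) :
    g.map (algebraMap ℂ R) ∈ wordSpan d B.toSubring x := by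
  obtain ⟨c, hc⟩ := hg
  have key : g.map (algebraMap ℂ R) = (⟨_, B.algebraMap_mem c⟩ : B.toSubring) •
      (1 : Matrix (Fin N) (Fin N) R) + ∑ i : Fin N, ∑ j : Fin N,
        (⟨_, B.algebraMap_mem (g i j - if i = j then c else 0)⟩ : B.toSubring) •
          Matrix.single i j (1 : R) := by
    rw [Matrix.matrix_eq_sum_single (g.map (algebraMap ℂ R)),
      Matrix.matrix_eq_sum_single (1 : Matrix (Fin N) (Fin N) R), Finset.smul_sum,
      ← Finset.sum_add_distrib]
    refine Finset.sum_congr rfl fun i _ => ?_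
    rw [Finset.smul_sum, ← Finset.sum_add_distrib]
    refine Finset.sum_congr rfl fun j _ => ?_
    simp only [Subring.smul_def, Matrix.smul_single, ← Matrix.single_add, Matrix.map_apply,
      smul_eq_mul, mul_one, Matrix.one_apply]
    congr 1
    split_ifs <;> simp
  rw [key]
  refine add_mem (Submodule.smul_mem _ _ (Submodule.subset_span (Or.inl ⟨[], by simp⟩)))
    (sum_mem fun i _ => sum_mem fun j _ => ?_)
  by_cases h : (i : ℕ) < d ∧ (j : ℕ) < d
  · exact Submodule.smul_mem _ _
      (Submodule.subset_span (Or.inr ⟨[], [], i, j, h.1, h.2, by simp⟩))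
  · rw [not_and_or, not_lt, not_lt] at h
    have : (⟨_, B.algebraMap_mem (g i j - if i = j then c else 0)⟩ : B.toSubring) = 0 := by
      ext
      simp [hc i j h]
    rw [this, zero_smul]
    exact zero_mem _

section Commutant

variable {N d n : ℕ}

/-- Matrices which agree with a scalar matrix outside the lower right `(N - d) × (N - d)` block. -/
def scalarCornerSubmodule (N d : ℕ) : Submodule ℂ (Matrix (Fin N) (Fin N) ℂ) where
  carrier := {Z | ∃ c : ℂ, ∀ i j : Fin N, ((i : ℕ) < d ∨ (j : ℕ) < d) →
    Z i j = if i = j then c else 0}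
  zero_mem' := ⟨0, fun i j _ => by simp⟩
  add_mem' := by
    rintro Y Z ⟨a, ha⟩ ⟨b, hb⟩
    refine ⟨a + b, fun i j hij => ?_⟩
    rw [Matrix.add_apply, ha i j hij, hb i j hij]
    split_ifs <;> simp
  smul_mem' := by
    rintro t Z ⟨a, ha⟩
    refine ⟨t * a, fun i j hij => ?_⟩
    rw [Matrix.smul_apply, ha i j hij]
    split_ifs <;> simp

/-- The units of the form `diag(1_d, h)`. -/
def IsCornerUnit (d : ℕ) (g : (Matrix (Fin N) (Fin N) ℂ)ˣ) : Prop :=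
  ∀ i j : Fin N, ((i : ℕ) < d ∨ (j : ℕ) < d) →
    (g : Matrix (Fin N) (Fin N) ℂ) i j = if i = j then 1 else 0

theorem commute_permTensor_const_neg {T : Matrix (Fin n → Fin N) (Fin n → Fin N) ℂ}
    (hT : ∀ g : (Matrix (Fin N) (Fin N) ℂ)ˣ, IsCornerUnit d g →
      Commute T (permTensor 1 fun _ => (g : Matrix (Fin N) (Fin N) ℂ)))
    {Z : Matrix (Fin N) (Fin N) ℂ} (hZ : Z ∈ scalarCornerSubmodule N d) :
    Commute T (permTensor 1 fun _ => -Z) := by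
  obtain ⟨c, hc⟩ := hZ
  have hs : ∀ s : ℂ, Z.charpoly.eval s ≠ 0 → s ≠ c →
      Commute T (permTensor 1 fun _ => s • (1 : Matrix (Fin N) (Fin N) ℂ) - Z) := by
    intro s h1 h2
    have h2' : s - c ≠ 0 := sub_ne_zero.2 h2
    have hdet : IsUnit ((s - c)⁻¹ • (s • (1 : Matrix (Fin N) (Fin N) ℂ) - Z)).det := by
      rw [Matrix.det_smul, isUnit_iff_ne_zero]
      refine mul_ne_zero (pow_ne_zero _ (inv_ne_zero h2')) ?_
      rwa [Matrix.eval_charpoly, Matrix.scalar_apply, ← Matrix.smul_one_eq_diagonal] at h1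
    have h := hT (((Matrix.isUnit_iff_isUnit_det _).2 hdet).unit) (fun i j hij => by
      rw [IsUnit.unit_spec, Matrix.smul_apply, Matrix.sub_apply, hc i j hij, Matrix.smul_apply,
        Matrix.one_apply]
      split_ifs
      · simp [h2']
      · simp)
    rw [IsUnit.unit_spec, permTensor_smul] at h
    have h' := h.smul_right ((s - c) ^ n)
    rwa [smul_smul, ← mul_pow, mul_inv_cancel₀ h2', one_pow, one_smul] at h'
  ext I J
  let Q : Matrix (Fin n → Fin N) (Fin n → Fin N) (Polynomial ℂ) :=
    permTensor 1 fun _ => Z.charmatrix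
  let D := T.map Polynomial.C * Q - Q * T.map Polynomial.C
  have hQ : ∀ s, Q.map (Polynomial.eval s) =
      permTensor 1 fun _ => s • (1 : Matrix (Fin N) (Fin N) ℂ) - Z := by
    intro s
    ext I J
    simp only [Q, permTensor, Matrix.map_apply, Matrix.of_apply, Polynomial.eval_prod]
    refine Finset.prod_congr rfl fun k _ => ?_
    simp only [Matrix.charmatrix_apply, Matrix.sub_apply, Matrix.smul_apply, Matrix.one_apply,
      Matrix.diagonal_apply]
    split_ifs <;> simp
  have hD : ∀ s, (D I J).eval s =
      (T * Q.map (Polynomial.eval s)) I J - (Q.map (Polynomial.eval s) * T) I J := by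
    intro s
    simp [D, Matrix.mul_apply, Polynomial.eval_finsetSum]
  have hzero : D I J * (Z.charpoly * (Polynomial.X - Polynomial.C c)) = 0 := by
    refine Polynomial.funext fun s => ?_
    by_cases h1 : Z.charpoly.eval s = 0
    · simp [h1]
    by_cases h2 : s = c
    · simp [h2]
    rw [Polynomial.eval_mul, hD, hQ, (hs s h1 h2).eq]
    simp
  have hD0 : D I J = 0 := (mul_eq_zero.1 hzero).resolve_right
    (mul_ne_zero Z.charpoly_monic.ne_zero (Polynomial.X_sub_C_ne_zero c))
  have := hD 0
  rw [hD0, hQ] at this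
  simp only [Polynomial.eval_zero, zero_smul, zero_sub] at this
  exact sub_eq_zero.1 this.symm

theorem commute_permTensor_const {T : Matrix (Fin n → Fin N) (Fin n → Fin N) ℂ}
    (hT : ∀ g : (Matrix (Fin N) (Fin N) ℂ)ˣ, IsCornerUnit d g →
      Commute T (permTensor 1 fun _ => (g : Matrix (Fin N) (Fin N) ℂ)))
    {Z : Matrix (Fin N) (Fin N) ℂ} (hZ : Z ∈ scalarCornerSubmodule N d) :
    Commute T (permTensor 1 fun _ => Z) := by
  simpa using commute_permTensor_const_neg hT (neg_mem hZ)

theorem sum_permTensor_comp_perm (Y : Fin n → Matrix (Fin N) (Fin N) ℂ) :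
    ∑ σ : Equiv.Perm (Fin n), permTensor 1 (fun k => Y (σ k)) =
      ∑ U : Finset (Fin n), (-1 : ℂ) ^ U.card • permTensor 1 fun _ => ∑ l ∈ Uᶜ, Y l := by
  ext I J
  simp only [Matrix.sum_apply, Matrix.smul_apply, permTensor, Matrix.of_apply, smul_eq_mul,
    Equiv.Perm.one_apply]
  exact sum_perm_prod_eq_sum_compl fun k l => Y l (I k) (J k)

theorem commute_sum_permTensor_comp_perm {T : Matrix (Fin n → Fin N) (Fin n → Fin N) ℂ}
    (hT : ∀ g : (Matrix (Fin N) (Fin N) ℂ)ˣ, IsCornerUnit d g →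
      Commute T (permTensor 1 fun _ => (g : Matrix (Fin N) (Fin N) ℂ)))
    (Y : Fin n → Matrix (Fin N) (Fin N) ℂ) (hY : ∀ k, Y k ∈ scalarCornerSubmodule N d) :
    Commute T (∑ σ : Equiv.Perm (Fin n), permTensor 1 (fun k => Y (σ k))) := by
  rw [sum_permTensor_comp_perm]
  exact Commute.sum_right _ _ _ fun U _ =>
    (commute_permTensor_const hT (sum_mem fun l _ => hY l)).smul_right _

/-- The left Kraus factors of the projection onto `scalarCornerSubmodule`. -/
def krausLeft (d : ℕ) (o : Fin N) : Option (Fin N) → Matrix (Fin N) (Fin N) ℂ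
  | none => Matrix.diagonal fun i => if (i : ℕ) < d then 0 else 1
  | some i => if (i : ℕ) < d then Matrix.single i o 1 else 0

/-- The right Kraus factors of the projection onto `scalarCornerSubmodule`. -/
def krausRight (d : ℕ) (o : Fin N) : Option (Fin N) → Matrix (Fin N) (Fin N) ℂ
  | none => Matrix.diagonal fun i => if (i : ℕ) < d then 0 else 1
  | some i => if (i : ℕ) < d then Matrix.single o i 1 else 0

theorem single_mem_cornerSubmonoid {i j : Fin N} (hi : (i : ℕ) < d) (hj : (j : ℕ) < d) :
    Matrix.single i j 1 ∈ cornerSubmonoid N d := by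
  refine ⟨0, fun k l h => ?_⟩
  have : ¬ (i = k ∧ j = l) := by
    rintro ⟨rfl, rfl⟩
    omega
  rw [Matrix.single_apply, if_neg this]
  simp

theorem diagonal_mem_cornerSubmonoid :
    (Matrix.diagonal fun i : Fin N => if (i : ℕ) < d then (0 : ℂ) else 1) ∈
      cornerSubmonoid N d := by
  refine ⟨1, fun k l h => ?_⟩
  rw [Matrix.diagonal_apply]
  by_cases hkl : k = l
  · subst hkl
    simp [not_lt.2 (or_self_iff.1 h)]
  · simp [hkl]

theorem zero_mem_cornerSubmonoid : (0 : Matrix (Fin N) (Fin N) ℂ) ∈ cornerSubmonoid N d :=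
  ⟨0, fun k l _ => by simp⟩

theorem krausLeft_mem {o : Fin N} (ho : (o : ℕ) < d) (a : Option (Fin N)) :
    krausLeft d o a ∈ cornerSubmonoid N d := by
  cases a with
  | none => exact diagonal_mem_cornerSubmonoid
  | some i =>
    simp only [krausLeft]
    split_ifs with h
    exacts [single_mem_cornerSubmonoid h ho, zero_mem_cornerSubmonoid]

theorem krausRight_mem {o : Fin N} (ho : (o : ℕ) < d) (a : Option (Fin N)) :
    krausRight d o a ∈ cornerSubmonoid N d := by
  cases a with
  | none => exact diagonal_mem_cornerSubmonoid
  | some i =>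
    simp only [krausRight]
    split_ifs with h
    exacts [single_mem_cornerSubmonoid ho h, zero_mem_cornerSubmonoid]

theorem sum_kraus_mul (o : Fin N) (Y : Matrix (Fin N) (Fin N) ℂ) (i j : Fin N) :
    (∑ a, krausLeft d o a * Y * krausRight d o a) i j =
      if (i : ℕ) < d ∨ (j : ℕ) < d then if i = j then Y o o else 0 else Y i j := by
  have h1 : ∀ k : Fin N, krausLeft d o (some k) * Y * krausRight d o (some k) =
      if (k : ℕ) < d then Matrix.single k k (Y o o) else 0 := by
    intro k
    simp only [krausLeft, krausRight]
    split_ifs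
    · rw [single_mul_mul_single, Matrix.smul_single, smul_eq_mul, mul_one]
    · simp
  rw [Fintype.sum_option, Matrix.add_apply, Matrix.sum_apply]
  simp only [h1]
  have h2 : ∀ k : Fin N, (if (k : ℕ) < d then Matrix.single k k (Y o o) else 0) i j =
      if k = i then (if (i : ℕ) < d ∧ i = j then Y o o else 0) else 0 := by
    intro k
    by_cases hk : k = i
    · subst hk
      by_cases hd : (k : ℕ) < d <;> simp [hd, Matrix.single_apply]
    · by_cases hd : (k : ℕ) < d <;> simp [hd, hk]
  simp only [h2, Finset.sum_ite_eq', Finset.mem_univ, if_true, krausLeft, krausRight,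
    Matrix.diagonal_mul, Matrix.mul_diagonal]
  by_cases hi : (i : ℕ) < d
  · simp [hi]
  · by_cases hj : (j : ℕ) < d
    · have : i ≠ j := by rintro rfl; exact hi hj
      simp [hi, hj, this]
    · simp [hi, hj]

theorem sum_kraus_mem (o : Fin N) (Y : Matrix (Fin N) (Fin N) ℂ) :
    ∑ a, krausLeft d o a * Y * krausRight d o a ∈ scalarCornerSubmodule N d :=
  ⟨Y o o, fun i j hij => by rw [sum_kraus_mul, if_pos hij]⟩

theorem sum_kraus_one (o : Fin N) : ∑ a, krausLeft d o a * krausRight d o a = 1 := by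
  ext i j
  have h := sum_kraus_mul (d := d) o 1 i j
  simp only [mul_one] at h
  rw [h]
  simp [Matrix.one_apply]

/-- Operators commuting with permutations and with the corner matrices in each tensor factor are
combinations of symmetrized tensor products of elements of `scalarCornerSubmodule`. -/
theorem factorial_smul_eq_of_commute {o : Fin N} (ho : (o : ℕ) < d)
    (b : Matrix (Fin n → Fin N) (Fin n → Fin N) ℂ)
    (hb : ∀ s ∈ permTensorSubmonoid n (cornerSubmonoid N d), s * b = b * s) :
    (n.factorial : ℂ) • b = ∑ I, ∑ J, b I J • ∑ σ : Equiv.Perm (Fin n),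
      permTensor 1 fun k => ∑ a, krausLeft d o a * Matrix.single (I (σ k)) (J (σ k)) 1 *
        krausRight d o a := by
  have hexp : b = ∑ I, ∑ J, b I J • permTensor 1 (fun k => Matrix.single (I k) (J k) 1) := by
    simp only [permTensor_single, Matrix.smul_single, smul_eq_mul, mul_one]
    exact Matrix.matrix_eq_sum_single b
  have hsym : ∀ σ : Equiv.Perm (Fin n), b = ∑ I, ∑ J, b I J • permTensor 1
      (fun k => Matrix.single (I (σ k)) (J (σ k)) 1) := by
    intro σ
    have hσ : permTensor σ (fun _ => 1) * b * permTensor σ⁻¹ (fun _ => 1) = b := by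
      rw [hb _ ⟨σ, _, fun _ => Submonoid.one_mem _, rfl⟩, Matrix.mul_assoc, permTensor_mul]
      simp [permTensor_one]
    conv_lhs => rw [← hσ, hexp]
    simp only [Finset.mul_sum, Finset.sum_mul, mul_smul_comm, smul_mul_assoc, permTensor_mul]
    simp
  have hkraus : ∑ a : Fin n → Option (Fin N), permTensor 1 (fun k => krausLeft d o (a k)) * b *
      permTensor 1 (fun k => krausRight d o (a k)) = b := by
    have : ∀ a : Fin n → Option (Fin N), permTensor 1 (fun k => krausLeft d o (a k)) * b *
        permTensor 1 (fun k => krausRight d o (a k)) =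
        b * permTensor 1 (fun k => krausLeft d o (a k) * krausRight d o (a k)) := by
      intro a
      rw [hb _ ⟨1, _, fun k => krausLeft_mem ho (a k), rfl⟩, Matrix.mul_assoc, permTensor_mul]
      simp
    simp only [this]
    rw [← Finset.mul_sum,
      ← permTensor_one_sum fun (_ : Fin n) a => krausLeft d o a * krausRight d o a]
    simp only [sum_kraus_one, permTensor_one, mul_one]
  have hboth : ∀ σ : Equiv.Perm (Fin n), b = ∑ I, ∑ J, b I J • permTensor 1
      (fun k => ∑ a, krausLeft d o a * Matrix.single (I (σ k)) (J (σ k)) 1 *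
        krausRight d o a) := by
    intro σ
    conv_lhs => rw [← hkraus, hsym σ]
    simp only [Finset.mul_sum, Finset.sum_mul, mul_smul_comm, smul_mul_assoc, permTensor_mul,
      permTensor_one_sum, Finset.smul_sum, Equiv.Perm.one_apply, mul_one]
    rw [Finset.sum_comm]
    exact Finset.sum_congr rfl fun I _ => Finset.sum_comm
  have hsum : ∑ _σ : Equiv.Perm (Fin n), b = (n.factorial : ℂ) • b := by
    simp [Fintype.card_perm, Nat.cast_smul_eq_nsmul]
  rw [← hsum, Finset.sum_congr rfl fun σ _ => hboth σ, Finset.sum_comm]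
  refine Finset.sum_congr rfl fun I _ => ?_
  rw [Finset.sum_comm]
  exact Finset.sum_congr rfl fun J _ => (Finset.smul_sum).symm

theorem mem_span_permTensorSubmonoid (hd : 1 ≤ d) (hdN : d < N)
    {T : Matrix (Fin n → Fin N) (Fin n → Fin N) ℂ}
    (hT : ∀ g : (Matrix (Fin N) (Fin N) ℂ)ˣ, IsCornerUnit d g →
      Commute T (permTensor 1 fun _ => (g : Matrix (Fin N) (Fin N) ℂ))) :
    T ∈ Submodule.span ℂ (permTensorSubmonoid n (cornerSubmonoid N d) :
      Set (Matrix (Fin n → Fin N) (Fin n → Fin N) ℂ)) := by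
  refine mem_span_of_commute_commutant _ ?_ T fun b hb => ?_
  · rintro _ ⟨σ, g, hg, rfl⟩
    exact ⟨_, _, fun k => conjTranspose_mem_cornerSubmonoid (hg _), conjTranspose_permTensor σ g⟩
  · have ho : ((⟨0, by omega⟩ : Fin N) : ℕ) < d := hd
    have h : Commute T ((n.factorial : ℂ) • b) := by
      rw [factorial_smul_eq_of_commute ho b hb]
      exact Commute.sum_right _ _ _ fun I _ => Commute.sum_right _ _ _ fun J _ =>
        (commute_sum_permTensor_comp_perm hT
          (fun k => ∑ a, krausLeft d ⟨0, by omega⟩ a * Matrix.single (I k) (J k) 1 *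
            krausRight d ⟨0, by omega⟩ a) fun k => sum_kraus_mem _ _).smul_right _
    have h' := h.smul_right (n.factorial : ℂ)⁻¹
    rwa [smul_smul, inv_mul_cancel₀ (Nat.cast_ne_zero.2 n.factorial_ne_zero), one_smul] at h'

end Commutant

section Forms

variable {κ : Type*} [Fintype κ] {n : ℕ}

/-- The homogeneous form with (not necessarily symmetric) coefficients `c`. -/
def homForm (c : (Fin n → κ) → ℂ) (x : κ → ℂ) : ℂ :=
  ∑ q, c q * ∏ k, x (q k)

theorem homForm_smul (c : (Fin n → κ) → ℂ) (t : ℂ) (x : κ → ℂ) :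
    homForm c (t • x) = t ^ n * homForm c x := by
  simp only [homForm, Pi.smul_apply, smul_eq_mul, Finset.prod_mul_distrib, Finset.prod_const,
    Finset.card_univ, Fintype.card_fin, Finset.mul_sum]
  exact Finset.sum_congr rfl fun q _ => by ring

theorem exists_homForm_of_isHomogeneous (P : MvPolynomial κ ℂ) (hP : P.IsHomogeneous n) :
    ∃ c : (Fin n → κ) → ℂ, ∀ x, MvPolynomial.eval x P = homForm c x := by
  have hmem : (fun x => MvPolynomial.eval x P) ∈ Submodule.span ℂ
      (Set.range fun (q : Fin n → κ) (x : κ → ℂ) => ∏ k, x (q k)) := by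
    have h : (fun x => MvPolynomial.eval x P) =
        ∑ s ∈ P.support, P.coeff s • fun x : κ → ℂ => s.prod fun i e => x i ^ e := by
      funext x
      rw [MvPolynomial.eval_eq']
      simp [Finsupp.prod_fintype]
    rw [h]
    refine sum_mem fun s hs => Submodule.smul_mem _ _ (Submodule.subset_span ?_)
    have hlen : (Finsupp.toMultiset s).toList.length = n := by
      rw [Multiset.length_toList, Finsupp.card_toMultiset]
      have := hP (MvPolynomial.mem_support_iff.1 hs)
      rw [← this, Finsupp.weight_apply]
      simp [Finsupp.sum]
    refine ⟨fun k => (Finsupp.toMultiset s).toList.get (Fin.cast hlen.symm k), ?_⟩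
    funext x
    have h1 : ∏ k : Fin n, x ((Finsupp.toMultiset s).toList.get (Fin.cast hlen.symm k)) =
        ∏ k, x ((Finsupp.toMultiset s).toList.get k) :=
      Fintype.prod_equiv (finCongr hlen.symm) _ _ fun k => rfl
    have h2 : ((Finsupp.toMultiset s).map x).prod = s.prod fun i e => x i ^ e := by
      rw [Finsupp.toMultiset_map, Finsupp.prod_toMultiset, Finsupp.prod_mapDomain_index] <;>
        simp [pow_add]
    simp only [h1, ← h2]
    rw [← List.prod_ofFn]
    conv_rhs => rw [← Multiset.coe_toList (Finsupp.toMultiset s), Multiset.map_coe,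
      Multiset.prod_coe]
    congr 1
    exact List.ofFn_getElem_eq_map _ _
  obtain ⟨c, hc⟩ := (Submodule.mem_span_range_iff_exists_fun ℂ).1 hmem
  refine ⟨c, fun x => ?_⟩
  have := congrFun hc x
  simpa [homForm] using this.symm

theorem exists_sum_homForm (P : MvPolynomial κ ℂ) :
    ∃ (D : ℕ) (c : ∀ n : ℕ, (Fin n → κ) → ℂ), ∀ x,
      MvPolynomial.eval x P = ∑ n ∈ Finset.range D, homForm (c n) x := by
  choose c hc using fun n => exists_homForm_of_isHomogeneous _
    (MvPolynomial.homogeneousComponent_isHomogeneous n P)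
  refine ⟨P.totalDegree + 1, c, fun x => ?_⟩
  conv_lhs => rw [← MvPolynomial.sum_homogeneousComponent P, map_sum]
  exact Finset.sum_congr rfl fun n _ => hc n x

theorem homForm_eq_of_sum_smul_eq (D : ℕ) (c : ∀ n : ℕ, (Fin n → κ) → ℂ) (x y : κ → ℂ)
    (h : ∀ t : ℂ, ∑ n ∈ Finset.range D, homForm (c n) (t • x) =
      ∑ n ∈ Finset.range D, homForm (c n) (t • y)) {n : ℕ} (hn : n < D) :
    homForm (c n) x = homForm (c n) y := by
  have hp : ∑ m ∈ Finset.range D, Polynomial.C (homForm (c m) x) * Polynomial.X ^ m =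
      ∑ m ∈ Finset.range D, Polynomial.C (homForm (c m) y) * Polynomial.X ^ m := by
    refine Polynomial.funext fun t => ?_
    have ht := h t
    simp only [homForm_smul, mul_comm (t ^ _)] at ht
    simpa only [Polynomial.eval_finsetSum, Polynomial.eval_mul, Polynomial.eval_C,
      Polynomial.eval_pow, Polynomial.eval_X] using ht
  have := congrArg (fun p => Polynomial.coeff p n) hp
  simpa [Polynomial.finsetSum_coeff, Polynomial.coeff_X_pow, hn] using this

theorem sum_symmetrized_mul_prod (c : (Fin n → κ) → ℂ) (Y : Fin n → κ → ℂ) :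
    ∑ q : Fin n → κ, (∑ σ : Equiv.Perm (Fin n), c (q ∘ σ)) * ∏ k, Y k (q k) =
      ∑ σ : Equiv.Perm (Fin n), ∑ q : Fin n → κ, c q * ∏ k, Y (σ k) (q k) := by
  simp only [Finset.sum_mul]
  rw [Finset.sum_comm]
  refine Finset.sum_congr rfl fun σ _ => ?_
  refine Fintype.sum_equiv (Equiv.arrowCongr σ.symm (Equiv.refl κ)) _ _ fun q => ?_
  have : ∏ k, Y k (q k) = ∏ k, Y (σ k) (q (σ k)) :=
    (Equiv.prod_comp σ fun k => Y k (q k)).symm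
  rw [this]
  rfl

theorem sum_symmetrized_mul_prod_eq_polarization (c : (Fin n → κ) → ℂ) (Y : Fin n → κ → ℂ) :
    ∑ q : Fin n → κ, (∑ σ : Equiv.Perm (Fin n), c (q ∘ σ)) * ∏ k, Y k (q k) =
      ∑ U : Finset (Fin n), (-1) ^ U.card * homForm c (∑ l ∈ Uᶜ, Y l) := by
  rw [sum_symmetrized_mul_prod, Finset.sum_comm]
  simp only [homForm, Finset.mul_sum]
  rw [Finset.sum_comm (γ := Finset (Fin n))]
  refine Finset.sum_congr rfl fun q _ => ?_
  rw [← Finset.mul_sum, sum_perm_prod_eq_sum_compl fun k l => Y l (q k), Finset.mul_sum]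
  refine Finset.sum_congr rfl fun U _ => ?_
  simp only [Finset.sum_apply]
  ring

end Forms

section Invariants

variable {L N d n : ℕ}

/-- The entries of a tuple of matrices as a vector. -/
def entries (X : Fin L → Matrix (Fin N) (Fin N) ℂ) : Fin L × Fin N × Fin N → ℂ :=
  fun q => X q.1 q.2.1 q.2.2

theorem sum_arrow_prod {A B C : Type*} [Fintype A] [Fintype B] [Fintype C]
    (F : (Fin n → A × B × C) → ℂ) :
    ∑ q, F q = ∑ a : Fin n → A, ∑ i : Fin n → B, ∑ j : Fin n → C,
      F fun k => (a k, i k, j k) := by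
  simp only [← Fintype.sum_prod_type']
  exact Fintype.sum_equiv ((Equiv.arrowProdEquivProdArrow _ _ _).trans
    (Equiv.prodCongr (Equiv.refl _) (Equiv.arrowProdEquivProdArrow _ _ _))) _ _ fun q => rfl

/-- The operator on tensor space representing the part of the polarization of a form which takes
its arguments in the slots `α`. -/
def formOperator (c : (Fin n → Fin L × Fin N × Fin N) → ℂ) (α : Fin n → Fin L) :
    Matrix (Fin n → Fin N) (Fin n → Fin N) ℂ :=
  Matrix.of fun J I => ∑ σ : Equiv.Perm (Fin n), c ((fun k => (α k, I k, J k)) ∘ σ)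

theorem trace_formOperator_mul (c : (Fin n → Fin L × Fin N × Fin N) → ℂ) (α : Fin n → Fin L)
    (y : Fin n → Matrix (Fin N) (Fin N) ℂ) :
    (formOperator c α * permTensor 1 y).trace = ∑ I : Fin n → Fin N, ∑ J : Fin n → Fin N,
      (∑ σ : Equiv.Perm (Fin n), c ((fun k => (α k, I k, J k)) ∘ σ)) *
        ∏ k, y k (I k) (J k) := by
  rw [Finset.sum_comm]
  rfl

theorem sum_trace_formOperator (c : (Fin n → Fin L × Fin N × Fin N) → ℂ)
    (X : Fin L → Matrix (Fin N) (Fin N) ℂ) :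
    ∑ α : Fin n → Fin L, (formOperator c α * permTensor 1 fun k => X (α k)).trace =
      n.factorial * homForm c (entries X) := by
  have h := sum_symmetrized_mul_prod c fun _ => entries X
  rw [sum_arrow_prod] at h
  simp only [trace_formOperator_mul]
  refine Eq.trans h ?_
  simp [homForm, Fintype.card_perm]

theorem trace_formOperator_eq_polarization (c : (Fin n → Fin L × Fin N × Fin N) → ℂ)
    (α : Fin n → Fin L) (y : Fin n → Matrix (Fin N) (Fin N) ℂ) :
    (formOperator c α * permTensor 1 y).trace =
      ∑ U : Finset (Fin n), (-1) ^ U.card *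
        homForm c (entries (∑ l ∈ Uᶜ, fun β => if α l = β then y l else 0)) := by
  have h := sum_symmetrized_mul_prod_eq_polarization c
    fun k => entries fun β => if α k = β then y k else 0
  have he : ∀ U : Finset (Fin n), entries (∑ l ∈ Uᶜ, fun β => if α l = β then y l else 0) =
      ∑ l ∈ Uᶜ, entries fun β => if α l = β then y l else 0 := by
    intro U
    funext q
    simp [entries, Matrix.sum_apply]
  simp only [he]
  rw [← h, sum_arrow_prod, trace_formOperator_mul, Finset.sum_eq_single α]
  · simp [entries]
  · intro β _ hβ
    obtain ⟨k, hk⟩ := Function.ne_iff.1 hβ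
    refine Finset.sum_eq_zero fun I _ => Finset.sum_eq_zero fun J _ => ?_
    rw [Finset.prod_eq_zero (Finset.mem_univ k), mul_zero]
    simp [entries, Ne.symm hk]
  · simp

theorem commute_formOperator (c : (Fin n → Fin L × Fin N × Fin N) → ℂ) (α : Fin n → Fin L)
    (g : (Matrix (Fin N) (Fin N) ℂ)ˣ)
    (hg : ∀ X : Fin L → Matrix (Fin N) (Fin N) ℂ,
      homForm c (entries fun β => (g : Matrix (Fin N) (Fin N) ℂ) * X β *
        ((g⁻¹ : (Matrix (Fin N) (Fin N) ℂ)ˣ) : Matrix (Fin N) (Fin N) ℂ)) =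
      homForm c (entries X)) :
    Commute (formOperator c α) (permTensor 1 fun _ => (g : Matrix (Fin N) (Fin N) ℂ)) := by
  set T := formOperator c α
  set G := permTensor 1 fun _ : Fin n => (g : Matrix (Fin N) (Fin N) ℂ) with hG
  set G' := permTensor 1 fun _ : Fin n =>
    ((g⁻¹ : (Matrix (Fin N) (Fin N) ℂ)ˣ) : Matrix (Fin N) (Fin N) ℂ) with hG'
  have hGG' : G * G' = 1 := by
    rw [hG, hG', permTensor_mul, one_mul]
    simp only [Units.mul_inv, permTensor_one]
  have hinv : ∀ y : Fin n → Matrix (Fin N) (Fin N) ℂ,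
      (T * (G * permTensor 1 y * G')).trace = (T * permTensor 1 y).trace := by
    intro y
    rw [hG, hG', permTensor_mul, permTensor_mul, one_mul, one_mul,
      trace_formOperator_eq_polarization, trace_formOperator_eq_polarization]
    refine Finset.sum_congr rfl fun U _ => ?_
    refine congrArg _ (Eq.trans ?_ (hg _))
    congr 2
    funext β
    simp only [Finset.sum_apply, Finset.mul_sum, Finset.sum_mul, Equiv.Perm.one_apply]
    refine Finset.sum_congr rfl fun l _ => ?_
    split_ifs <;> simp
  have hT : G' * T * G = T := by
    ext J I
    have h := hinv fun k => Matrix.single (I k) (J k) 1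
    rw [permTensor_single, ← Matrix.mul_assoc, Matrix.trace_mul_comm, ← Matrix.mul_assoc,
      ← Matrix.mul_assoc, Matrix.trace_mul_single, Matrix.trace_mul_single] at h
    simpa using h
  calc T * G = (G * G') * (T * G) := by rw [hGG', one_mul]
    _ = G * (G' * T * G) := by simp only [Matrix.mul_assoc]
    _ = G * T := by rw [hT]

end Invariants

section Generators

variable {L N d n : ℕ}

/-- The matrices of coordinate functions. -/
def coordMatrix (L N : ℕ) (α : Fin L) :
    Matrix (Fin N) (Fin N) ((Fin L → Matrix (Fin N) (Fin N) ℂ) → ℂ) :=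
  Matrix.of fun i j X => X α i j

theorem prod_coordMatrix_apply (w : List (Fin L)) (i j : Fin N)
    (X : Fin L → Matrix (Fin N) (Fin N) ℂ) :
    (w.map (coordMatrix L N)).prod i j X = wordProd L N X w i j := by
  have h := map_list_prod (Pi.evalRingHom
    (fun _ : Fin L → Matrix (Fin N) (Fin N) ℂ => ℂ) X).mapMatrix (w.map (coordMatrix L N))
  rw [List.map_map] at h
  exact congrFun (congrFun h i) j

theorem trace_mul_mem_adjoin {T : Matrix (Fin n → Fin N) (Fin n → Fin N) ℂ}
    (hT : T ∈ Submodule.span ℂ (permTensorSubmonoid n (cornerSubmonoid N d) :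
      Set (Matrix (Fin n → Fin N) (Fin n → Fin N) ℂ))) (α : Fin n → Fin L)
    (A : Subalgebra ℂ ((Fin L → Matrix (Fin N) (Fin N) ℂ) → ℂ))
    (hW : ∀ w : List (Fin L), w ≠ [] → pW L N w ∈ A)
    (hE : ∀ (w : List (Fin L)) (i j : Fin N), w ≠ [] → (i : ℕ) < d → (j : ℕ) < d →
      pE L N w i j ∈ A) :
    (fun X : Fin L → Matrix (Fin N) (Fin N) ℂ =>
      (T * permTensor 1 fun k => X (α k)).trace) ∈ A := by
  induction hT using Submodule.span_induction with
  | zero =>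
    simp only [zero_mul, Matrix.trace_zero]
    exact A.zero_mem
  | add S T _ _ hS hT =>
    simp only [add_mul, Matrix.trace_add]
    exact A.add_mem hS hT
  | smul c T _ hT =>
    simp only [smul_mul_assoc, Matrix.trace_smul]
    exact A.smul_mem hT c
  | mem T hT =>
    obtain ⟨σ, g, hg, rfl⟩ := hT
    have hentry : ∀ (w : List (Fin L)) (i j : Fin N), w ≠ [] → (i : ℕ) < d → (j : ℕ) < d →
        (w.map (coordMatrix L N)).prod i j ∈ A.toSubring := by
      intro w i j hw hi hj
      have : (w.map (coordMatrix L N)).prod i j = pE L N w i j :=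
        funext fun X => prod_coordMatrix_apply w i j X
      rw [this]
      exact hE w i j hw hi hj
    have htrace : ∀ w : List (Fin L), w ≠ [] →
        (w.map (coordMatrix L N)).prod.trace ∈ A.toSubring := by
      intro w hw
      have : (w.map (coordMatrix L N)).prod.trace = pW L N w := by
        funext X
        simp [Matrix.trace, Finset.sum_apply, prod_coordMatrix_apply, pW]
      rw [this]
      exact hW w hw
    let M : Subsemigroup (Matrix (Fin N) (Fin N) ((Fin L → Matrix (Fin N) (Fin N) ℂ) → ℂ)) :=
      { carrier := wordSpan d A.toSubring (coordMatrix L N)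
        mul_mem' := fun h h' => mul_mem_wordSpan hentry h h' }
    have h := sum_prod_perm_mem A.toSubring M
      (fun m hm => trace_mem_of_mem_wordSpan htrace hentry hm) n σ
      (fun k => (g k).map (algebraMap ℂ _) * coordMatrix L N (α (σ k)))
      (fun k => mul_mem_wordSpan hentry (map_mem_wordSpan_of_mem_cornerSubmonoid A _ (hg k))
        (letter_mem_wordSpan _))
    refine (congrArg (· ∈ A) ?_).mpr h
    funext X
    rw [permTensor_mul, one_mul]
    simp only [permTensor, Matrix.trace, Matrix.diag_apply, Matrix.of_apply, Finset.sum_apply,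
      Finset.prod_apply, Matrix.mul_apply, Pi.mul_apply, Matrix.map_apply, coordMatrix]
    rfl

end Generators

/-- Let `1 ≤ d < N` and let `f : (Mat(N,ℂ))^L → ℂ` be a polynomial
function invariant under simultaneous conjugation by every invertible block-diagonal
matrix `g = diag(1_d, h)`, `h ∈ GL(N−d,ℂ)` (i.e. every invertible `g` whose entries
`g_{ij}` with `i ≤ d` or `j ≤ d` agree with those of the identity matrix).  Then `f`
belongs to the unital `ℂ`-subalgebra generated by the trace-word functions `p_{w;N}`
(`w ∈ W_L`) together with the matrix-entry functions `p_{ij;w;N}` (`w ∈ W_L`,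
`1 ≤ i,j ≤ d`). -/
theorem stmt8 (L N d : ℕ) (hL : 1 ≤ L) (hd : 1 ≤ d) (hdN : d < N)
    (f : (Fin L → Matrix (Fin N) (Fin N) ℂ) → ℂ)
    (hpoly : IsPolyFun L N f)
    (hinv : ∀ g : (Matrix (Fin N) (Fin N) ℂ)ˣ,
      (∀ i j : Fin N, ((i : ℕ) < d ∨ (j : ℕ) < d) →
        (g : Matrix (Fin N) (Fin N) ℂ) i j = if i = j then 1 else 0) →
      ∀ X : Fin L → Matrix (Fin N) (Fin N) ℂ,
        f (fun α => (g : Matrix (Fin N) (Fin N) ℂ) * X α *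
          ((g⁻¹ : (Matrix (Fin N) (Fin N) ℂ)ˣ) : Matrix (Fin N) (Fin N) ℂ)) = f X) :
    f ∈ Algebra.adjoin ℂ
      ({p | ∃ v : List (Fin L), v ≠ [] ∧ p = pW L N v} ∪
       {p | ∃ (v : List (Fin L)) (i j : Fin N),
          v ≠ [] ∧ (i : ℕ) < d ∧ (j : ℕ) < d ∧ p = pE L N v i j}) := by
  obtain ⟨P, hP⟩ := hpoly
  obtain ⟨D, c, hc⟩ := exists_sum_homForm P
  have hf : ∀ X, f X = ∑ n ∈ Finset.range D, homForm (c n) (entries X) := fun X =>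
    (hP X).trans (hc _)
  set A := Algebra.adjoin ℂ
    ({p | ∃ v : List (Fin L), v ≠ [] ∧ p = pW L N v} ∪
     {p | ∃ (v : List (Fin L)) (i j : Fin N),
        v ≠ [] ∧ (i : ℕ) < d ∧ (j : ℕ) < d ∧ p = pE L N v i j}) with hA
  have hW : ∀ w : List (Fin L), w ≠ [] → pW L N w ∈ A := fun w hw =>
    Algebra.subset_adjoin (Or.inl ⟨w, hw, rfl⟩)
  have hE : ∀ (w : List (Fin L)) (i j : Fin N), w ≠ [] → (i : ℕ) < d → (j : ℕ) < d →
      pE L N w i j ∈ A := fun w i j hw hi hj =>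
    Algebra.subset_adjoin (Or.inr ⟨w, i, j, hw, hi, hj, rfl⟩)
  have hsum : f = ∑ n ∈ Finset.range D, fun X => homForm (c n) (entries X) := by
    funext X
    rw [hf, Finset.sum_apply]
  rw [hsum]
  refine sum_mem fun n hn => ?_
  have hn' : n < D := Finset.mem_range.1 hn
  have hform : ∀ g : (Matrix (Fin N) (Fin N) ℂ)ˣ, IsCornerUnit d g →
      ∀ X : Fin L → Matrix (Fin N) (Fin N) ℂ,
      homForm (c n) (entries fun β => (g : Matrix (Fin N) (Fin N) ℂ) * X β *
        ((g⁻¹ : (Matrix (Fin N) (Fin N) ℂ)ˣ) : Matrix (Fin N) (Fin N) ℂ)) =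
      homForm (c n) (entries X) := by
    intro g hg X
    refine homForm_eq_of_sum_smul_eq D c _ _ (fun t => ?_) hn'
    have h := hinv g hg (t • X)
    have ht : (entries fun β => (g : Matrix (Fin N) (Fin N) ℂ) * (t • X) β *
        ((g⁻¹ : (Matrix (Fin N) (Fin N) ℂ)ˣ) : Matrix (Fin N) (Fin N) ℂ)) =
        t • entries fun β => (g : Matrix (Fin N) (Fin N) ℂ) * X β *
          ((g⁻¹ : (Matrix (Fin N) (Fin N) ℂ)ˣ) : Matrix (Fin N) (Fin N) ℂ) := by
      funext q
      simp [entries]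
    rw [hf, hf, ht] at h
    exact h
  have hmem : (∑ α : Fin n → Fin L, fun X : Fin L → Matrix (Fin N) (Fin N) ℂ =>
      (formOperator (c n) α * permTensor 1 fun k => X (α k)).trace) ∈ A :=
    sum_mem fun α _ => trace_mul_mem_adjoin (mem_span_permTensorSubmonoid hd hdN fun g hg =>
      commute_formOperator (c n) α g (hform g hg)) α A hW hE
  have h := A.smul_mem hmem (n.factorial : ℂ)⁻¹
  convert h using 1
  funext X
  rw [Pi.smul_apply, Finset.sum_apply, sum_trace_formOperator, smul_eq_mul, ← mul_assoc,
    inv_mul_cancel₀ (Nat.cast_ne_zero.2 n.factorial_ne_zero), one_mul]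
end
end
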